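/- arXiv:2210.13308 — 5 statements merged into one kernel-verified Lean document; each statement's English description precedes it below -/
import Mathlib

section
/- Let s₀ > 0 and let φ : (0, s₀] → ℝ be monotone non-decreasing with φ(s) > 0 for every s ∈ (0, s₀]. Suppose there are constants C₀ > 0 and δ > 0 such that t·φ(s−t) ≤ C₀·φ(s)^{1+δ} for all 0 < t < s ≤ s₀. Then s₀ ≤ (2·C₀/(1 − 2^{−δ}))·φ(s₀)^{δ}; in particular φ(s₀) ≥ c₀ := (s₀·(1 − 2^{−δ})/(2C₀))^{1/δ} > 0, a constant depending only on s₀, C₀ and δ. -/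
/-- Geometric decay along the iteration: with `r = 2^(-δ)` and `K * (1 - r) = 2 * C₀ * φ s₀ ^ δ`,
the function `φ` has been halved `j` times below the level `s₀ - K * (1 - r ^ j)`. -/
theorem le_half_pow_of_growth {s₀ C₀ δ K : ℝ} {φ : ℝ → ℝ} (hC₀ : 0 < C₀) (hδ : 0 < δ)
    (hK : 0 ≤ K) (hKr : K * (1 - 2 ^ (-δ)) = 2 * C₀ * φ s₀ ^ δ)
    (hpos : ∀ s, 0 < s → s ≤ s₀ → 0 < φ s)
    (hmono : ∀ s t, 0 < s → s ≤ t → t ≤ s₀ → φ s ≤ φ t)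
    (hgrowth : ∀ t s, 0 < t → t < s → s ≤ s₀ → t * φ (s - t) ≤ C₀ * φ s ^ (1 + δ))
    (j : ℕ) : ∀ s, 0 < s → s < s₀ - K * (1 - ((2 : ℝ) ^ (-δ)) ^ j) →
      φ s ≤ φ s₀ * (1 / 2) ^ j := by
  have hr : ((1 / 2 : ℝ)) ^ δ = 2 ^ (-δ) := by
    rw [one_div, Real.inv_rpow zero_le_two, Real.rpow_neg zero_le_two]
  have hr0 : (0 : ℝ) < 2 ^ (-δ) := by positivity
  have hr1 : (2 : ℝ) ^ (-δ) < 1 := Real.rpow_lt_one_of_one_lt_of_neg one_lt_two (neg_lt_zero.2 hδ)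
  induction j with
  | zero => intro s h0 hs; simpa using hmono s s₀ h0 (by simpa using hs.le) le_rfl
  | succ j ih =>
    intro s' h0 hs'
    set r : ℝ := 2 ^ (-δ)
    have hrj : r ^ j ≤ 1 := pow_le_one₀ hr0.le hr1.le
    have hstep : K * (1 - r ^ (j + 1)) = K * (1 - r ^ j) + 2 * C₀ * φ s₀ ^ δ * r ^ j := by
      rw [← hKr]; ring
    obtain ⟨s, hs1, hs2⟩ := exists_between
      (show s' + 2 * C₀ * φ s₀ ^ δ * r ^ j < s₀ - K * (1 - r ^ j) by linarith)
    have hKj : 0 ≤ K * (1 - r ^ j) := mul_nonneg hK (by linarith)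
    have hs₀ : 0 < φ s₀ := by
      have : 0 ≤ K * (1 - r ^ (j + 1)) :=
        mul_nonneg hK (sub_nonneg.2 (pow_le_one₀ hr0.le hr1.le))
      exact hpos s₀ (by linarith) le_rfl
    have hA : 0 < 2 * C₀ * φ s₀ ^ δ * r ^ j := by positivity
    have hsp : 0 < s := by linarith
    have hM : 0 < φ s₀ * (1 / 2) ^ j := by positivity
    have hgr := hgrowth (s - s') s (by linarith) (by linarith) (by linarith)
    rw [sub_sub_cancel] at hgr
    have hφs' : 0 < φ s' := hpos s' h0 (by linarith)
    have hpow : φ s ^ (1 + δ) ≤ φ s₀ * (1 / 2) ^ j * (φ s₀ ^ δ * r ^ j) := by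
      calc φ s ^ (1 + δ) ≤ (φ s₀ * (1 / 2) ^ j) ^ (1 + δ) :=
            Real.rpow_le_rpow (hpos s hsp (by linarith)).le (ih s hsp hs2) (by linarith)
        _ = φ s₀ * (1 / 2) ^ j * (φ s₀ ^ δ * r ^ j) := by
            rw [Real.rpow_add hM, Real.rpow_one, Real.mul_rpow hs₀.le (by positivity),
              ← Real.rpow_pow_comm (by norm_num), hr]
    have hlower : 2 * C₀ * φ s₀ ^ δ * r ^ j * φ s' ≤ (s - s') * φ s' :=
      mul_le_mul_of_nonneg_right (by linarith) hφs'.le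
    have hupper := mul_le_mul_of_nonneg_left hpow hC₀.le
    refine le_of_mul_le_mul_left ?_ hA
    calc _ ≤ _ := hlower.trans (hgr.trans hupper)
      _ = _ := by ring

/-- De Giorgi's iteration lemma (increasing form): if `φ : (0,s₀] → ℝ` is monotone
non-decreasing, positive, and satisfies `t·φ(s−t) ≤ C₀·φ(s)^(1+δ)` for all `0 < t < s ≤ s₀`,
then `s₀ ≤ (2C₀/(1−2^(−δ)))·φ(s₀)^δ`, and in particular
`φ(s₀) ≥ (s₀(1−2^(−δ))/(2C₀))^(1/δ) > 0`. -/
theorem stmt1 (s₀ : ℝ) (hs₀ : 0 < s₀) (φ : ℝ → ℝ) (C₀ δ : ℝ) (hC₀ : 0 < C₀) (hδ : 0 < δ)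
    (hpos : ∀ s, 0 < s → s ≤ s₀ → 0 < φ s)
    (hmono : ∀ s t, 0 < s → s ≤ t → t ≤ s₀ → φ s ≤ φ t)
    (hgrowth : ∀ t s, 0 < t → t < s → s ≤ s₀ → t * φ (s - t) ≤ C₀ * φ s ^ (1 + δ)) :
    s₀ ≤ 2 * C₀ / (1 - 2 ^ (-δ)) * φ s₀ ^ δ ∧
      (s₀ * (1 - 2 ^ (-δ)) / (2 * C₀)) ^ (1 / δ) ≤ φ s₀ := by
  have hr0 : (0 : ℝ) < 2 ^ (-δ) := by positivity
  have hr1 : (2 : ℝ) ^ (-δ) < 1 := Real.rpow_lt_one_of_one_lt_of_neg one_lt_two (neg_lt_zero.2 hδ)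
  have h1r : (0 : ℝ) < 1 - 2 ^ (-δ) := sub_pos.2 hr1
  have hφ : 0 < φ s₀ := hpos s₀ hs₀ le_rfl
  have hmain : s₀ ≤ 2 * C₀ / (1 - 2 ^ (-δ)) * φ s₀ ^ δ := by
    by_contra! hlt
    set K := 2 * C₀ / (1 - 2 ^ (-δ)) * φ s₀ ^ δ with hKdef
    have hK : 0 < K := by positivity
    have hKr : K * (1 - 2 ^ (-δ)) = 2 * C₀ * φ s₀ ^ δ := by
      rw [hKdef]; field_simp
    obtain ⟨s, h0, hs⟩ := exists_between (sub_pos.2 hlt)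
    have hbound (j : ℕ) : φ s ≤ φ s₀ * (1 / 2) ^ j := by
      refine le_half_pow_of_growth hC₀ hδ hK.le hKr hpos hmono hgrowth j s h0 ?_
      have : 0 < K * ((2 : ℝ) ^ (-δ)) ^ j := by positivity
      linarith
    have hlim : Filter.Tendsto (fun j : ℕ => φ s₀ * (1 / 2 : ℝ) ^ j) Filter.atTop (nhds 0) := by
      simpa using (tendsto_pow_atTop_nhds_zero_of_lt_one (r := (1 / 2 : ℝ))
        (by norm_num) (by norm_num)).const_mul (φ s₀)
    exact (hpos s h0 (by linarith)).not_ge (ge_of_tendsto' hlim hbound)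
  refine ⟨hmain, ?_⟩
  rw [one_div, Real.rpow_inv_le_iff_of_pos (by positivity) hφ.le hδ, div_le_iff₀ (by positivity)]
  rw [div_mul_eq_mul_div, le_div_iff₀ h1r] at hmain
  linarith
end

section
/- For every real p ≥ 1 there exists a constant c_p > 0 such that for all u > 0 and v ≥ 0: (i) u·v^p ≤ u·(log(1+u))^p + v^p·(e^v − 1); and (ii) u·(log(1+u))^p + v^p·(e^v − 1) ≤ c_p·( u·(1 + |log u|^p) + e^{2v} ). -/
theorem log_one_add_le_one_add_abs_log {u : ℝ} (hu : 0 < u) :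
    Real.log (1 + u) ≤ 1 + |Real.log u| := by
  rcases le_total u 1 with h | h
  · have h1 := Real.log_le_sub_one_of_pos (show 0 < 1 + u by linarith)
    have h2 := abs_nonneg (Real.log u)
    linarith
  · have h1 : Real.log (1 + u) ≤ Real.log (2 * u) :=
      Real.log_le_log (by linarith) (by linarith)
    rw [Real.log_mul two_ne_zero hu.ne'] at h1
    have h2 := Real.log_le_sub_one_of_pos (show (0 : ℝ) < 2 by norm_num)
    have h3 := le_abs_self (Real.log u)
    linarith

theorem one_add_rpow_le {a p : ℝ} (ha : 0 ≤ a) (hp : 0 ≤ p) :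
    (1 + a) ^ p ≤ 2 ^ p * (1 + a ^ p) := by
  have hap : 0 ≤ a ^ p := Real.rpow_nonneg ha p
  have h2p : (0 : ℝ) ≤ 2 ^ p := by positivity
  rcases le_total a 1 with h | h
  · calc (1 + a) ^ p ≤ 2 ^ p := Real.rpow_le_rpow (by linarith) (by linarith) hp
      _ ≤ 2 ^ p * (1 + a ^ p) := le_mul_of_one_le_right h2p (by linarith)
  · calc (1 + a) ^ p ≤ (2 * a) ^ p := Real.rpow_le_rpow (by linarith) (by linarith) hp
      _ = 2 ^ p * a ^ p := Real.mul_rpow zero_le_two ha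
      _ ≤ 2 ^ p * (1 + a ^ p) := mul_le_mul_of_nonneg_left (by linarith) h2p

theorem rpow_le_rpow_self_mul_exp {v p : ℝ} (hv : 0 ≤ v) (hp : 0 < p) :
    v ^ p ≤ p ^ p * Real.exp v := by
  have h : v ≤ p * Real.exp (v / p) := by
    have h1 := Real.add_one_le_exp (v / p)
    calc v = p * (v / p) := by field_simp
      _ ≤ p * Real.exp (v / p) := mul_le_mul_of_nonneg_left (by linarith) hp.le
  calc v ^ p ≤ (p * Real.exp (v / p)) ^ p := Real.rpow_le_rpow hv h hp.le
    _ = p ^ p * Real.exp v := by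
      rw [Real.mul_rpow hp.le (Real.exp_pos _).le, ← Real.exp_mul, div_mul_cancel₀ _ hp.ne']


/-- For every `p ≥ 1` there is `c_p > 0` such that for all `u > 0`, `v ≥ 0`:
(i) `u·v^p ≤ u·(log(1+u))^p + v^p·(e^v − 1)` and
(ii) `u·(log(1+u))^p + v^p·(e^v − 1) ≤ c_p·(u·(1 + |log u|^p) + e^{2v})`. -/
theorem stmt3 (p : ℝ) (hp : 1 ≤ p) :
    ∃ c : ℝ, 0 < c ∧ ∀ u v : ℝ, 0 < u → 0 ≤ v →
      u * v ^ p ≤ u * Real.log (1 + u) ^ p + v ^ p * (Real.exp v - 1) ∧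
      u * Real.log (1 + u) ^ p + v ^ p * (Real.exp v - 1) ≤
        c * (u * (1 + |Real.log u| ^ p) + Real.exp (2 * v)) := by
  have hp0 : 0 < p := by linarith
  refine ⟨2 ^ p + p ^ p, by positivity, fun u v hu hv => ?_⟩
  have hlog : 0 ≤ Real.log (1 + u) := Real.log_nonneg (by linarith)
  have hvp : 0 ≤ v ^ p := Real.rpow_nonneg hv p
  constructor
  · rcases le_total v (Real.log (1 + u)) with h | h
    · have h1 := mul_le_mul_of_nonneg_left (Real.rpow_le_rpow hv h hp0.le) hu.le
      have h2 := mul_nonneg hvp (sub_nonneg.2 (Real.one_le_exp hv))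
      linarith
    · have h1 : 1 + u ≤ Real.exp v := (Real.log_le_iff_le_exp (by linarith)).1 h
      have h2 := mul_le_mul_of_nonneg_left (show u ≤ Real.exp v - 1 by linarith) hvp
      have h3 := mul_nonneg hu.le (Real.rpow_nonneg hlog p)
      linarith
  · have h1 : u * Real.log (1 + u) ^ p ≤ 2 ^ p * (u * (1 + |Real.log u| ^ p)) := by
      have h := (Real.rpow_le_rpow hlog (log_one_add_le_one_add_abs_log hu) hp0.le).trans
        (one_add_rpow_le (abs_nonneg (Real.log u)) hp0.le)
      linarith [mul_le_mul_of_nonneg_left h hu.le]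
    have h2 : v ^ p * (Real.exp v - 1) ≤ p ^ p * Real.exp (2 * v) := by
      have h := mul_le_mul_of_nonneg_right (rpow_le_rpow_self_mul_exp hv hp0) (Real.exp_pos v).le
      rw [two_mul, Real.exp_add]
      linarith
    have h3 : 0 ≤ p ^ p * (u * (1 + |Real.log u| ^ p)) := by positivity
    have h4 : 0 ≤ 2 ^ p * Real.exp (2 * v) := by positivity
    linarith
end

section
/- Let m ≥ 1, x₀ ∈ ℝ^m, r₀ > 0 and M ≥ 0. Let ψ be a continuous convex function on the closed ball of radius 2r₀ centered at x₀, with ψ = 0 on the boundary sphere {|x − x₀| = 2r₀} and ψ ≥ −M on the ball. Then at every point x in the open ball B(x₀, r₀) at which ψ is differentiable, the gradient satisfies ‖∇ψ(x)‖ ≤ M/r₀. -/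
/-- A convex function lies above its tangent at a point of differentiability. -/
theorem ConvexOn.fderiv_sub_le {E : Type*} [NormedAddCommGroup E] [NormedSpace ℝ E]
    {s : Set E} {f : E → ℝ} (hf : ConvexOn ℝ s f) {x y : E} (hx : x ∈ s) (hy : y ∈ s)
    (hd : DifferentiableAt ℝ f x) : fderiv ℝ f x (y - x) ≤ f y - f x := by
  have hg := hf.comp_affineMap (AffineMap.lineMap x y)
  have hd' : HasFDerivAt f (fderiv ℝ f x) (AffineMap.lineMap x y (0 : ℝ)) := by
    simpa using hd.hasFDerivAt
  have hderiv := hd'.comp_hasDerivAt (0 : ℝ) AffineMap.hasDerivAt_lineMap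
  have h := hg.le_slope_of_hasDerivAt (x := 0) (y := 1) (by simpa using hx) (by simpa using hy)
    one_pos hderiv
  simpa [slope_def_field] using h

/-- A ray starting inside a ball meets the boundary sphere. -/
theorem exists_pos_add_smul_mem_sphere {E : Type*} [NormedAddCommGroup E] [NormedSpace ℝ E]
    {c x v : E} {R : ℝ} (hx : x ∈ Metric.ball c R) (hv : v ≠ 0) :
    ∃ t : ℝ, 0 ≤ t ∧ x + t • v ∈ Metric.sphere c R := by
  have hx' : ‖x - c‖ < R := by simpa [dist_eq_norm] using hx
  have hR : 0 < R := (norm_nonneg _).trans_lt hx'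
  have hv' : 0 < ‖v‖ := norm_pos_iff.mpr hv
  have hT : 0 ≤ 2 * R / ‖v‖ := by positivity
  have hcont : Continuous fun t : ℝ ↦ ‖x + t • v - c‖ := by fun_prop
  have hend : R ≤ ‖x + (2 * R / ‖v‖) • v - c‖ := by
    have h1 : ‖(2 * R / ‖v‖) • v‖ = 2 * R := by
      rw [norm_smul, Real.norm_of_nonneg hT, div_mul_cancel₀ _ hv'.ne']
    have h2 := norm_sub_le (x + (2 * R / ‖v‖) • v - c) (x - c)
    rw [show x + (2 * R / ‖v‖) • v - c - (x - c) = (2 * R / ‖v‖) • v by abel, h1] at h2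
    linarith
  obtain ⟨t, ht, htR⟩ := intermediate_value_Icc hT hcont.continuousOn
    (show R ∈ Set.Icc _ _ from ⟨by simpa using hx'.le, hend⟩)
  exact ⟨t, ht.1, by simpa [dist_eq_norm] using htR⟩

/-- Gradient estimate for convex functions: if `ψ` is continuous and convex on the closed
ball of radius `2r₀` centered at `x₀`, vanishes on the boundary sphere and is bounded
below by `−M`, then at every differentiability point `x` in the open ball of radius `r₀`,
`‖∇ψ(x)‖ ≤ M/r₀`. -/
theorem stmt12 {m : ℕ} (hm : 1 ≤ m) (x₀ : EuclideanSpace ℝ (Fin m)) (r₀ M : ℝ)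
    (hr₀ : 0 < r₀) (hM : 0 ≤ M) (ψ : EuclideanSpace ℝ (Fin m) → ℝ)
    (hcont : ContinuousOn ψ (Metric.closedBall x₀ (2 * r₀)))
    (hconv : ConvexOn ℝ (Metric.closedBall x₀ (2 * r₀)) ψ)
    (hbdry : ∀ x ∈ Metric.sphere x₀ (2 * r₀), ψ x = 0)
    (hlower : ∀ x ∈ Metric.closedBall x₀ (2 * r₀), -M ≤ ψ x)
    (x : EuclideanSpace ℝ (Fin m)) (hx : x ∈ Metric.ball x₀ r₀)
    (hdiff : DifferentiableAt ℝ ψ x) :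
    ‖fderiv ℝ ψ x‖ ≤ M / r₀ := by
  have bound (v : EuclideanSpace ℝ (Fin m)) : fderiv ℝ ψ x v ≤ M / r₀ * ‖v‖ := by
    rcases eq_or_ne v 0 with rfl | hv
    · simp
    have hx2 : x ∈ Metric.ball x₀ (2 * r₀) := Metric.ball_subset_ball (by linarith) hx
    obtain ⟨t, ht, hts⟩ := exists_pos_add_smul_mem_sphere hx2 hv
    have htan := hconv.fderiv_sub_le (Metric.ball_subset_closedBall hx2)
      (Metric.sphere_subset_closedBall hts) hdiff
    rw [hbdry _ hts, add_sub_cancel_left, map_smul, smul_eq_mul] at htan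
    have hxM := hlower x (Metric.ball_subset_closedBall hx2)
    have hlen : r₀ ≤ t * ‖v‖ := by
      have h1 := norm_add_le (x - x₀) (t • v)
      rw [show x - x₀ + t • v = x + t • v - x₀ by abel, norm_smul,
        Real.norm_of_nonneg ht, mem_sphere_iff_norm.mp hts] at h1
      have h2 := mem_ball_iff_norm.mp hx
      linarith
    have ht0 : 0 < t := by
      refine ht.lt_of_ne fun h ↦ ?_
      rw [← h, zero_mul] at hlen
      linarith
    refine le_of_mul_le_mul_left ?_ ht0
    calc t * fderiv ℝ ψ x v ≤ M := by linarith
      _ = M / r₀ * r₀ := (div_mul_cancel₀ _ hr₀.ne').symm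
      _ ≤ M / r₀ * (t * ‖v‖) := by gcongr
      _ = t * (M / r₀ * ‖v‖) := by ring
  refine ContinuousLinearMap.opNorm_le_bound _ (by positivity) fun v ↦ ?_
  rw [Real.norm_eq_abs, abs_le']
  exact ⟨bound v, by simpa using bound (-v)⟩
end

section
/- Let U ⊆ ℝ^m be open and let g̃ and J be differentiable maps from U into the m×m real matrices such that at every point x ∈ U: g̃(x) is symmetric positive definite, J(x)² = −I, and J(x)ᵀ·g̃(x)·J(x) = g̃(x). Write g̃_{ij} for the entries of g̃, g̃^{ij} for the entries of g̃⁻¹, and J_i^j for the entry of J in row j and column i (so that (JY)^j = Σ_i J_i^j Y^i). Define ω_{ij} = Σ_k g̃_{ik}·J_j^k. If the cyclic sum ∂ω_{ij}/∂x^l + ∂ω_{li}/∂x^j + ∂ω_{jl}/∂x^i = 0 holds on U for all indices i, j, l (i.e. the 2-form ω is closed), then for every index l and every point of U: Σ_{i,k} g̃^{ik}·∂g̃_{kl}/∂x^i − (1/2)·Σ_{i,k} g̃^{ik}·∂g̃_{ik}/∂x^l = −(1/2)·Σ_{j,k} J_k^j·∂J_j^k/∂x^l − Σ_{i,k,j,p}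 g̃^{ik}·g̃_{lp}·J_j^p·∂J_k^j/∂x^i. -/
/-- Partial derivative in the `l`-th coordinate direction. -/
noncomputable def pd {m : ℕ} (l : Fin m) (f : (Fin m → ℝ) → ℝ) (x : Fin m → ℝ) : ℝ :=
  fderiv ℝ f x (Pi.single l 1)

open Matrix in
/-- Matrix form of the identity: `dG i`, `dA i`, `dW i` play the role of the `i`-th partial
derivatives of the metric `G`, of the transposed complex structure `A` and of the 2-form
`W = -(A * G)`. -/
theorem contracted_christoffel_of_closed {ι : Type*} [Fintype ι] [DecidableEq ι]
    (G H A : Matrix ι ι ℝ) (dG dA dW : ι → Matrix ι ι ℝ)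
    (hG : Gᵀ = G) (hGH : G * H = 1) (hAA : A * A = -1) (hAGA : A * G * Aᵀ = G)
    (hdA : ∀ l, dA l * A + A * dA l = 0)
    (hdW : ∀ l, dW l = -(dA l * G + A * dG l))
    (hskew : ∀ l, (dW l)ᵀ = -dW l)
    (hclosed : ∀ i j l, dW l i j + dW j l i + dW i j l = 0) (l : ι) :
    ∑ i, (H * dG i) i l - (1 / 2) * (H * dG l).trace =
      -(1 / 2) * (A * dA l).trace - ∑ i, (H * dA i * A * G) i l := by
  have hHG : H * G = 1 := mul_eq_one_comm.mp hGH
  have hH : Hᵀ = H := by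
    have h : Hᵀ * G = 1 := by
      rw [← hG, ← transpose_mul, hGH, transpose_one]
    calc Hᵀ = Hᵀ * (G * H) := by rw [hGH, mul_one]
      _ = H := by rw [← mul_assoc, h, one_mul]
  have hGA : G * Aᵀ = -(A * G) := by
    have h : A * (A * G * Aᵀ) = A * G := by rw [hAGA]
    rw [mul_assoc A G, ← mul_assoc, hAA, neg_one_mul] at h
    rw [← h, neg_neg]
  have hΩ : (H * A)ᵀ = -(H * A) := by
    rw [transpose_mul, hH]
    calc Aᵀ * H = H * (G * Aᵀ) * H := by rw [← mul_assoc, hHG, one_mul]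
      _ = -(H * A * (G * H)) := by rw [hGA]; noncomm_ring
      _ = -(H * A) := by rw [hGH, mul_one]
  have hΩ' : ∀ i j, (H * A) j i = -(H * A) i j := fun i j => congrFun (congrFun hΩ i) j
  have hskew' : ∀ k i j, dW k j i = -dW k i j := fun k i j =>
    congrFun (congrFun (hskew k) i) j
  have hdA' : ∀ i, dA i * A = -(A * dA i) := fun i => eq_neg_of_add_eq_zero_left (hdA i)
  have hsum : ∑ i, ∑ j, (H * A) i j * dW l i j + 2 * ∑ i, (H * A * dW i) i l = 0 := by
    have h₁ : ∑ i, ∑ j, (H * A) i j * dW j l i = ∑ i, (H * A * dW i) i l := by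
      rw [Finset.sum_comm]
      refine Finset.sum_congr rfl fun i _ => ?_
      rw [mul_apply (M := H * A)]
      refine Finset.sum_congr rfl fun j _ => ?_
      rw [hΩ' i j, hskew' i j l, neg_mul_neg]
    have h₂ : ∑ i, ∑ j, (H * A) i j * dW i j l = ∑ i, (H * A * dW i) i l := rfl
    have h₃ : ∑ i, ∑ j, (H * A) i j * (dW l i j + dW j l i + dW i j l) = 0 := by
      simp [hclosed]
    simp only [mul_add, Finset.sum_add_distrib] at h₃
    rw [h₁, h₂] at h₃
    linarith
  have htrace : ∑ i, ∑ j, (H * A) i j * dW l i j = (A * dA l).trace - (H * dG l).trace := by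
    have h₁ : ∑ i, ∑ j, (H * A) i j * dW l i j = -(H * A * dW l).trace := by
      simp only [trace, diag_apply]
      rw [← Finset.sum_neg_distrib]
      refine Finset.sum_congr rfl fun i _ => ?_
      rw [mul_apply (M := H * A), ← Finset.sum_neg_distrib]
      refine Finset.sum_congr rfl fun j _ => ?_
      rw [hskew' l j i, mul_neg]
    have h₂ : H * A * dW l = -(H * (A * dA l * G)) - H * (A * A) * dG l := by
      rw [hdW]; noncomm_ring
    rw [h₁, h₂, hAA, trace_sub, trace_neg, trace_mul_comm H, mul_assoc (A * dA l), hGH]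
    simp
    ring
  have hdiv : ∀ i, H * A * dW i = H * dA i * A * G + H * dG i := by
    intro i
    have h₁ : H * A * dW i = -(H * (A * dA i) * G) - H * (A * A) * dG i := by
      rw [hdW]; noncomm_ring
    rw [h₁, hAA, mul_assoc H (dA i), hdA']
    noncomm_ring
  simp only [hdiv, Matrix.add_apply, Finset.sum_add_distrib] at hsum
  rw [htrace] at hsum
  linarith

theorem pd_congr {m : ℕ} {U : Set (Fin m → ℝ)} (hU : IsOpen U) {f h : (Fin m → ℝ) → ℝ}
    (hfh : ∀ y ∈ U, f y = h y) {x : Fin m → ℝ} (hx : x ∈ U) (l : Fin m) :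
    pd l f x = pd l h x := by
  have : f =ᶠ[nhds x] h := Filter.eventually_of_mem (hU.mem_nhds hx) hfh
  rw [pd, pd, this.fderiv_eq]

theorem pd_neg {m : ℕ} (l : Fin m) (f : (Fin m → ℝ) → ℝ) (x : Fin m → ℝ) :
    pd l (fun y => -f y) x = -pd l f x := by
  simp [pd, fderiv_fun_neg]

theorem pd_sum_mul {m : ℕ} {ι : Type*} [Fintype ι] {f h : ι → (Fin m → ℝ) → ℝ}
    {x : Fin m → ℝ} (hf : ∀ k, DifferentiableAt ℝ (f k) x)
    (hh : ∀ k, DifferentiableAt ℝ (h k) x) (l : Fin m) :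
    pd l (fun y => ∑ k, f k y * h k y) x =
      ∑ k, pd l (f k) x * h k x + ∑ k, f k x * pd l (h k) x := by
  have : HasFDerivAt (fun y => ∑ k, f k y * h k y) _ x :=
    HasFDerivAt.fun_sum fun k _ => (hf k).hasFDerivAt.mul (hh k).hasFDerivAt
  rw [pd, this.fderiv]
  simp [pd, Finset.sum_add_distrib, mul_comm, add_comm]

/-- The local identity for almost Kähler metrics: if `g̃` is a metric compatible with an
almost complex structure `J` (with `J² = −I`), and the associated 2-form
`ω_{ij} = Σ_k g̃_{ik} J_j^k` is closed, then
`Σ g̃^{ik} ∂_i g̃_{kl} − ½ Σ g̃^{ik} ∂_l g̃_{ik}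
  = −½ Σ J_k^j ∂_l J_j^k − Σ g̃^{ik} g̃_{lp} J_j^p ∂_i J_k^j`.
Here `g y i j` denotes `g̃_{ij}(y)` and `J y i j` denotes `J_i^j(y)`. -/
theorem stmt15 {m : ℕ} (U : Set (Fin m → ℝ)) (hU : IsOpen U)
    (g J : (Fin m → ℝ) → Fin m → Fin m → ℝ)
    (hgdiff : ∀ x ∈ U, ∀ i j, DifferentiableAt ℝ (fun y => g y i j) x)
    (hJdiff : ∀ x ∈ U, ∀ i j, DifferentiableAt ℝ (fun y => J y i j) x)
    (hgpos : ∀ x ∈ U, (Matrix.of (g x)).PosDef)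
    (hJ2 : ∀ x ∈ U, ∀ i k, ∑ j, J x i j * J x j k = -(if i = k then (1 : ℝ) else 0))
    (hcompat : ∀ x ∈ U, ∀ i j, ∑ p, ∑ q, J x i p * g x p q * J x j q = g x i j)
    (hclosed : ∀ x ∈ U, ∀ i j l,
      pd l (fun y => ∑ k, g y i k * J y j k) x +
        pd j (fun y => ∑ k, g y l k * J y i k) x +
        pd i (fun y => ∑ k, g y j k * J y l k) x = 0)
    (x : Fin m → ℝ) (hx : x ∈ U) (l : Fin m) :
    (∑ i, ∑ k, (Matrix.of (g x))⁻¹ i k * pd i (fun y => g y k l) x) -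
      (1 / 2) * ∑ i, ∑ k, (Matrix.of (g x))⁻¹ i k * pd l (fun y => g y i k) x =
    -(1 / 2) * (∑ j, ∑ k, J x k j * pd l (fun y => J y j k) x) -
      ∑ i, ∑ k, ∑ j, ∑ q, (Matrix.of (g x))⁻¹ i k * g x l q * J x j q *
        pd i (fun y => J y k j) x := by
  have hsymm : ∀ y ∈ U, ∀ i j, g y i j = g y j i := fun y hy i j => by
    simpa using (hgpos y hy).isHermitian.apply j i
  have hAA : ∀ y ∈ U, Matrix.of (J y) * Matrix.of (J y) = -1 := fun y hy => by
    ext i k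
    simpa [Matrix.mul_apply, Matrix.one_apply] using hJ2 y hy i k
  have hAGA : ∀ y ∈ U,
      Matrix.of (J y) * Matrix.of (g y) * (Matrix.of (J y)).transpose = Matrix.of (g y) := by
    intro y hy
    ext i j
    rw [Matrix.of_apply, ← hcompat y hy i j, Finset.sum_comm]
    simp [Matrix.mul_apply, Finset.sum_mul]
  have hω : ∀ y ∈ U, ∀ i j, ∑ k, g y i k * J y j k = -∑ k, J y i k * g y k j := by
    intro y hy i j
    have h := congrArg (Matrix.of (J y) * ·) (hAGA y hy)
    simp only [Matrix.mul_assoc] at h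
    rw [← Matrix.mul_assoc, hAA y hy, neg_one_mul] at h
    have h' := congrFun (congrFun h i) j
    simp only [Matrix.neg_apply, Matrix.mul_apply, Matrix.transpose_apply,
      Matrix.of_apply] at h'
    linarith
  have hskew : ∀ y ∈ U, ∀ i j, ∑ k, g y j k * J y i k = -∑ k, g y i k * J y j k := by
    intro y hy i j
    rw [hω y hy i j, neg_neg]
    exact Finset.sum_congr rfl fun k _ => by rw [hsymm y hy j k, mul_comm]
  have hdet : IsUnit (Matrix.of (g x)).det := (hgpos x hx).det_pos.ne'.isUnit
  have key := contracted_christoffel_of_closed (Matrix.of (g x)) (Matrix.of (g x))⁻¹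
    (Matrix.of (J x)) (fun i => Matrix.of fun a b => pd i (fun y => g y a b) x)
    (fun i => Matrix.of fun a b => pd i (fun y => J y a b) x)
    (fun i => Matrix.of fun a b => pd i (fun y => ∑ k, g y a k * J y b k) x)
    (by ext i j; exact hsymm x hx j i) (Matrix.mul_nonsing_inv _ hdet) (hAA x hx) (hAGA x hx)
    (fun i => by
      ext a b
      have h := pd_congr hU (fun y hy => hJ2 y hy a b) hx i
      rw [pd_sum_mul (fun k => hJdiff x hx a k) (fun k => hJdiff x hx k b)] at h
      simpa [Matrix.mul_apply, pd] using h)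
    (fun i => by
      ext a b
      have h := pd_congr hU (fun y hy => hω y hy a b) hx i
      rw [pd_neg, pd_sum_mul (fun k => hJdiff x hx a k) (fun k => hgdiff x hx k b)] at h
      simpa only [Matrix.mul_apply, Matrix.neg_apply, Matrix.add_apply, Matrix.of_apply]
        using h)
    (fun i => by
      ext a b
      have h := pd_congr hU (fun y hy => hskew y hy a b) hx i
      rw [pd_neg] at h
      exact h)
    (fun i j l => hclosed x hx i j l) l
  have htr : ∑ i, ∑ k, (Matrix.of (g x))⁻¹ i k * pd l (fun y => g y i k) x =
      ∑ i, ∑ k, (Matrix.of (g x))⁻¹ i k * pd l (fun y => g y k i) x :=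
    Finset.sum_congr rfl fun i _ => Finset.sum_congr rfl fun k _ => by
      rw [pd_congr hU (fun y hy => hsymm y hy i k) hx]
  have hlast : ∀ i, ∑ k, ∑ j, ∑ q, (Matrix.of (g x))⁻¹ i k * g x l q * J x j q *
      pd i (fun y => J y k j) x =
      ((Matrix.of (g x))⁻¹ * (Matrix.of fun a b => pd i (fun y => J y a b) x) *
        Matrix.of (J x) * Matrix.of (g x)) i l := by
    intro i
    rw [Matrix.mul_assoc, Matrix.mul_assoc, Matrix.mul_apply]
    simp only [Matrix.mul_apply, Matrix.of_apply, Finset.mul_sum]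
    refine Finset.sum_congr rfl fun k _ => Finset.sum_congr rfl fun j _ =>
      Finset.sum_congr rfl fun q _ => ?_
    rw [hsymm x hx l q]
    ring
  have htrJ : ∑ j, ∑ k, J x k j * pd l (fun y => J y j k) x =
      ∑ k, ∑ j, J x k j * pd l (fun y => J y j k) x := Finset.sum_comm
  simp only [hlast]
  rw [htr, htrJ]
  simpa only [Matrix.trace, Matrix.diag_apply,
    Matrix.mul_apply (M := (Matrix.of (g x))⁻¹) (N := Matrix.of _), Matrix.mul_apply (M := Matrix.of (J x)),
    Matrix.of_apply] using key
end

section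
/- Let (X, μ) be a finite measure space and f : X → ℝ a measurable function whose negative part max(−f, 0) is μ-integrable. For s ≥ 0 set Ω_s = {x ∈ X : f(x) < −s} and A_s = ∫_{Ω_s} (−f(x) − s) dμ(x). Let n ≥ 1 be an integer, p > n a real number, K > 0, and set δ₀ = (p−n)/(np). Suppose that for every s ≥ 0 one has ∫_{Ω_s} (−f − s)^{p(n+1)/n} dμ ≤ K·A_s^{p/n}. Then f ≥ −S₀ holds μ-almost everywhere, where S₀ := 2·K^{1/p}·μ(X)^{δ₀}/(1 − 2^{−δ₀}). -/
open MeasureTheory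

/-- **De Giorgi's iteration lemma**, with an explicit vanishing threshold. -/
theorem deGiorgi_iteration {φ : ℝ → ℝ} {C M δ : ℝ} (hC : 0 < C) (hM : 0 < M) (hδ : 0 < δ)
    (hφ : Antitone φ) (hφ_nonneg : ∀ s, 0 ≤ φ s) (hφ_zero : φ 0 ≤ M)
    (h : ∀ s r, 0 ≤ s → 0 < r → r * φ (s + r) ≤ C * φ s ^ (1 + δ)) :
    φ (2 * C * M ^ δ / (1 - 2 ^ (-δ))) = 0 := by
  set ρ : ℝ := 2 ^ (-δ) with hρ_def
  have hρ : 0 < ρ := by positivity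
  have hρ1 : ρ < 1 := Real.rpow_lt_one_of_one_lt_of_neg (by norm_num) (by linarith)
  have hρ' : 0 < 1 - ρ := by linarith
  have hMδ : 0 < M ^ δ := by positivity
  set S := 2 * C * M ^ δ / (1 - ρ) with hS_def
  have hS : 0 < S := by positivity
  have hSρ : S * (1 - ρ) = 2 * C * M ^ δ := div_mul_cancel₀ _ hρ'.ne'
  have key : ∀ k : ℕ, φ (S * (1 - ρ ^ k)) ≤ (1 / 2) ^ k * M := by
    intro k
    induction k with
    | zero => simpa using hφ_zero
    | succ k ih =>
      have hρk : ρ ^ k ≤ 1 := pow_le_one₀ hρ.le hρ1.le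
      have hpow : ((1 / 2 : ℝ) ^ k) ^ δ = ρ ^ k := by
        rw [← Real.rpow_natCast, ← Real.rpow_natCast, ← Real.rpow_mul (by norm_num), hρ_def,
          ← Real.rpow_mul (by norm_num), one_div, Real.inv_rpow (by norm_num),
          ← Real.rpow_neg (by norm_num)]
        ring_nf
      have hr : 0 < 2 * C * M ^ δ * ρ ^ k := by positivity
      have hstep := h (S * (1 - ρ ^ k)) _ (mul_nonneg hS.le (by linarith)) hr
      have hs : S * (1 - ρ ^ k) + 2 * C * M ^ δ * ρ ^ k = S * (1 - ρ ^ (k + 1)) := by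
        rw [← hSρ]; ring
      rw [hs] at hstep
      have hbound : φ (S * (1 - ρ ^ k)) ^ (1 + δ) ≤ (1 / 2) ^ k * M * (ρ ^ k * M ^ δ) :=
        calc φ (S * (1 - ρ ^ k)) ^ (1 + δ) ≤ ((1 / 2) ^ k * M) ^ (1 + δ) :=
              Real.rpow_le_rpow (hφ_nonneg _) ih (by linarith)
          _ = (1 / 2) ^ k * M * (ρ ^ k * M ^ δ) := by
              rw [Real.rpow_add (by positivity), Real.rpow_one,
                Real.mul_rpow (by positivity) hM.le, hpow]
      refine le_of_mul_le_mul_left (hstep.trans ?_) hr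
      calc C * φ (S * (1 - ρ ^ k)) ^ (1 + δ) ≤ C * ((1 / 2) ^ k * M * (ρ ^ k * M ^ δ)) := by gcongr
        _ = 2 * C * M ^ δ * ρ ^ k * ((1 / 2) ^ (k + 1) * M) := by ring
  have hlim : Filter.Tendsto (fun k : ℕ => (1 / 2 : ℝ) ^ k * M) Filter.atTop (nhds 0) := by
    simpa using (tendsto_pow_atTop_nhds_zero_of_lt_one (by norm_num : (0 : ℝ) ≤ 1 / 2)
      (by norm_num)).mul_const M
  refine le_antisymm (ge_of_tendsto' hlim fun k => (hφ ?_).trans (key k)) (hφ_nonneg _)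
  nlinarith [pow_pos hρ k]

/-- Hölder's inequality against the constant function `1`. -/
theorem lintegral_le_rpow_mul_measure_univ_rpow {X : Type*} [MeasurableSpace X] (ν : Measure X)
    {g : X → ENNReal} (hg : AEMeasurable g ν) {q : ℝ} (hq : 1 < q) :
    ∫⁻ x, g x ∂ν ≤ (∫⁻ x, g x ^ q ∂ν) ^ (1 / q) * ν Set.univ ^ (1 - 1 / q) := by
  have hconj := Real.HolderConjugate.conjExponent hq
  have h := ENNReal.lintegral_mul_le_Lp_mul_Lq ν hconj hg (aemeasurable_const (b := (1 : ENNReal)))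
  simpa [← hconj.one_sub_inv] using h

/-- Solving the self-referential bound on `a` that Hölder's inequality produces. -/
theorem le_rpow_mul_rpow_of_le_holder {n p K a m : ℝ} (hn : 0 < n) (hp : 0 < p) (hK : 0 ≤ K)
    (ha : 0 ≤ a) (hm : 0 ≤ m)
    (h : a ≤ (K * a ^ (p / n)) ^ (1 / (p * (n + 1) / n)) *
      m ^ (1 - 1 / (p * (n + 1) / n))) :
    a ≤ K ^ (1 / p) * m ^ (1 + (p - n) / (n * p)) := by
  rcases ha.eq_or_lt with rfl | ha
  · positivity
  have h' := Real.rpow_le_rpow ha.le h (by positivity : 0 ≤ (n + 1) / n)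
  rw [Real.mul_rpow (by positivity) (by positivity), ← Real.rpow_mul (by positivity),
    ← Real.rpow_mul hm, Real.mul_rpow hK (by positivity), ← Real.rpow_mul ha.le] at h'
  have e1 : 1 / (p * (n + 1) / n) * ((n + 1) / n) = 1 / p := by field_simp
  have e2 : (1 - 1 / (p * (n + 1) / n)) * ((n + 1) / n) = 1 + (p - n) / (n * p) := by
    field_simp; ring
  have e3 : p / n * (1 / p) = 1 / n := by field_simp
  have e4 : (n + 1) / n = 1 + 1 / n := by field_simp
  rw [e1, e2, e3, e4, Real.rpow_add ha, Real.rpow_one] at h'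
  refine le_of_mul_le_mul_right (h'.trans_eq ?_) (by positivity : 0 < a ^ (1 / n))
  ring

/-- Abstract De Giorgi iteration scheme: on a finite measure space, if `f` has integrable
negative part and for every `s ≥ 0` the deficit integrals satisfy
`∫_{Ω_s}(−f−s)^{p(n+1)/n} dμ ≤ K·A_s^{p/n}` with `Ω_s = {f < −s}` and
`A_s = ∫_{Ω_s}(−f−s) dμ`, then `f ≥ −S₀` a.e. with
`S₀ = 2·K^{1/p}·μ(X)^{δ₀}/(1 − 2^{−δ₀})`, `δ₀ = (p−n)/(np)`. -/
theorem stmt18 {X : Type*} [MeasurableSpace X] (μ : Measure X) [IsFiniteMeasure μ]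
    (f : X → ℝ) (hf : Measurable f)
    (hint : Integrable (fun x => max (-f x) 0) μ)
    (n : ℕ) (hn : 1 ≤ n) (p K : ℝ) (hp : (n : ℝ) < p) (hK : 0 < K)
    (hyp : ∀ s : ℝ, 0 ≤ s →
      ∫⁻ x in {x | f x < -s}, ENNReal.ofReal ((-f x - s) ^ (p * ((n : ℝ) + 1) / n)) ∂μ ≤
        ENNReal.ofReal K *
          (∫⁻ x in {x | f x < -s}, ENNReal.ofReal (-f x - s) ∂μ) ^ (p / (n : ℝ))) :
    ∀ᵐ x ∂μ,
      -(2 * K ^ (1 / p) * (μ Set.univ).toReal ^ ((p - n) / (n * p)) /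
        (1 - 2 ^ (-((p - n) / (n * p))))) ≤ f x := by
  have hn0 : (0 : ℝ) < n := by exact_mod_cast hn
  have hp0 : 0 < p := hn0.trans hp
  rcases eq_or_ne μ 0 with rfl | hμ
  · simp
  have hM : 0 < (μ Set.univ).toReal :=
    ENNReal.toReal_pos (by simpa using hμ) (measure_ne_top _ _)
  have hδ : 0 < (p - n) / (n * p) := div_pos (by linarith) (by positivity)
  have hΩ : ∀ s : ℝ, MeasurableSet {x | f x < -s} := fun s => hf measurableSet_Iio
  have hΩ_mono : ∀ s t : ℝ, s ≤ t → {x | f x < -t} ⊆ {x | f x < -s} := fun s t hst x hx =>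
    lt_of_lt_of_le hx (neg_le_neg hst)
  set A : ℝ → ENNReal := fun s => ∫⁻ x in {x | f x < -s}, ENNReal.ofReal (-f x - s) ∂μ
  have hA : ∀ s, 0 ≤ s → A s ≠ ⊤ := by
    intro s hs
    refine ne_top_of_le_ne_top hint.lintegral_lt_top.ne
      ((setLIntegral_le_lintegral _ _).trans (lintegral_mono fun x => ENNReal.ofReal_le_ofReal ?_))
    exact le_max_of_le_left (by linarith)
  have hq : 1 < p * ((n : ℝ) + 1) / n := by
    rw [one_lt_div hn0]
    nlinarith
  have hHolder : ∀ s, 0 ≤ s →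
      (A s).toReal ≤ K ^ (1 / p) * μ.real {x | f x < -s} ^ (1 + (p - n) / (n * p)) := by
    intro s hs
    refine le_rpow_mul_rpow_of_le_holder hn0 hp0 hK.le ENNReal.toReal_nonneg
      measureReal_nonneg ?_
    have h := lintegral_le_rpow_mul_measure_univ_rpow (μ.restrict {x | f x < -s})
      (g := fun x => ENNReal.ofReal (-f x - s)) (by fun_prop) hq
    have hpow : ∫⁻ x in {x | f x < -s}, ENNReal.ofReal (-f x - s) ^ (p * ((n : ℝ) + 1) / n) ∂μ
        ≤ ENNReal.ofReal K * A s ^ (p / (n : ℝ)) := by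
      refine le_of_eq_of_le (setLIntegral_congr_fun (hΩ s) fun x hx => ?_) (hyp s hs)
      have hx' : f x < -s := hx
      exact ENNReal.ofReal_rpow_of_nonneg (by linarith) (by linarith)
    rw [Measure.restrict_apply_univ] at h
    have hq1 : 0 ≤ 1 - 1 / (p * ((n : ℝ) + 1) / n) := by
      rw [sub_nonneg, div_le_one (by linarith)]
      exact hq.le
    have hq2 : 0 ≤ 1 / (p * ((n : ℝ) + 1) / n) := by positivity
    have h2 := h.trans (mul_le_mul_left (ENNReal.rpow_le_rpow hpow hq2) _)
    have hfin : (ENNReal.ofReal K * A s ^ (p / (n : ℝ))) ^ (1 / (p * ((n : ℝ) + 1) / n)) *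
        μ {x | f x < -s} ^ (1 - 1 / (p * ((n : ℝ) + 1) / n)) ≠ ⊤ :=
      ENNReal.mul_ne_top (ENNReal.rpow_ne_top_of_nonneg hq2 (ENNReal.mul_ne_top
        ENNReal.ofReal_ne_top (ENNReal.rpow_ne_top_of_nonneg (by positivity) (hA s hs))))
        (ENNReal.rpow_ne_top_of_nonneg hq1 (measure_ne_top _ _))
    have h3 := ENNReal.toReal_mono hfin h2
    rwa [ENNReal.toReal_mul, ← ENNReal.toReal_rpow, ← ENNReal.toReal_rpow, ENNReal.toReal_mul,
      ← ENNReal.toReal_rpow, ENNReal.toReal_ofReal hK.le] at h3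
  have hCheb : ∀ s r, 0 ≤ s → 0 < r → r * μ.real {x | f x < -(s + r)} ≤ (A s).toReal := by
    intro s r hs hr
    have h : ENNReal.ofReal r * μ {x | f x < -(s + r)} ≤ A s := by
      rw [← setLIntegral_const]
      refine (setLIntegral_mono' (hΩ _) fun x hx => ENNReal.ofReal_le_ofReal ?_).trans
        (lintegral_mono_set (hΩ_mono s (s + r) (by linarith)))
      have hx' : f x < -(s + r) := hx
      linarith
    have h2 := ENNReal.toReal_mono (hA s hs) h
    rwa [ENNReal.toReal_mul, ENNReal.toReal_ofReal hr.le] at h2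
  have hnull := deGiorgi_iteration (φ := fun s => μ.real {x | f x < -s})
    (Real.rpow_pos_of_pos hK (1 / p)) hM hδ
    (fun s t hst => measureReal_mono (hΩ_mono s t hst)) (fun s => measureReal_nonneg)
    (measureReal_mono (Set.subset_univ _))
    (fun s r hs hr => (hCheb s r hs hr).trans (hHolder s hs))
  rw [measureReal_eq_zero_iff] at hnull
  simpa only [ae_iff, not_le] using hnull
end
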